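/- arXiv:2410.10397 — 6 statements merged into one kernel-verified Lean document; each statement's English description precedes it below -/
import Mathlib

section
/- Let b > 0 and β ≥ 0 be real numbers, let X be a set, let n ≥ 1, let f : X → ℝ^n be a function with f_i(x) ∈ [−b, b] for all x ∈ X and all i ∈ {1,…,n}, and let c ∈ ℝ^n. Define g : X → ℝ^n by g_i(x) = exp(β f_i(x) + c_i) / Σ_{k=1}^n exp(β f_k(x) + c_k). Then g satisfies (4βb)-LDP, i.e., g_i(x) ≤ exp(4βb) · g_i(x') for all x, x' ∈ X and all i ∈ {1,…,n}. -/
/-- Theorem 1 of the paper: the softmax of a `β`-scaled bounded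
function plus constants satisfies `4βb`-local differential privacy. -/
theorem softmax_of_bounded_satisfies_LDP {X : Type*} {n : ℕ} (hn : 1 ≤ n)
    (b β : ℝ) (hb : 0 < b) (hβ : 0 ≤ β)
    (f : X → Fin n → ℝ) (hf : ∀ x i, f x i ∈ Set.Icc (-b) b)
    (c : Fin n → ℝ) (g : X → Fin n → ℝ)
    (hg : ∀ x i, g x i =
      Real.exp (β * f x i + c i) / ∑ k, Real.exp (β * f x k + c k)) :
    ∀ (x x' : X) (i : Fin n), g x i ≤ Real.exp (4 * β * b) * g x' i := by
  intro x x' i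
  have exp_le (y y' : X) (k : Fin n) : Real.exp (β * f y k + c k) ≤
      Real.exp (2 * β * b) * Real.exp (β * f y' k + c k) := by
    rw [← Real.exp_add, Real.exp_le_exp]
    have h : β * (f y k - f y' k) ≤ β * (2 * b) :=
      mul_le_mul_of_nonneg_left (by linarith [(hf y k).2, (hf y' k).1]) hβ
    linarith
  have sum_pos (y : X) : 0 < ∑ k, Real.exp (β * f y k + c k) :=
    Finset.sum_pos (fun k _ => Real.exp_pos _) ⟨i, Finset.mem_univ i⟩
  have sum_le : ∑ k, Real.exp (β * f x' k + c k) ≤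
      Real.exp (2 * β * b) * ∑ k, Real.exp (β * f x k + c k) := by
    rw [Finset.mul_sum]
    exact Finset.sum_le_sum fun k _ => exp_le x' x k
  have exp_four : Real.exp (4 * β * b) = Real.exp (2 * β * b) * Real.exp (2 * β * b) := by
    rw [← Real.exp_add]
    ring_nf
  rw [hg, hg, ← mul_div_assoc, div_le_div_iff₀ (sum_pos x) (sum_pos x'), exp_four]
  calc _ ≤ _ := mul_le_mul (exp_le x x' i) sum_le (sum_pos x').le (by positivity)
    _ = _ := by ring
end

section
/- Let ε ≥ 0 and let Δ : ℝ² → ℝ be a convex function that is decreasing (antitone) in its first argument and increasing (monotone) in its second argument. Let g : X → ℝ^n be a gating function satisfying ε-LDP, let Q_1, …, Q_n be probability measures on the expert spaces H_1, …, H_n, and let x' ∈ X. Then Δ(e^ε · R_S(g, Q), e^{−ε} · R(g, Q)) ≤ Σ_{i=1}^n g_i(x') · Δ(R_S(Q_i), R(Q_i)). -/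
open MeasureTheory Real

/-- The expected loss under a probability measure on experts is an integrable function of the
labelled example. -/
theorem integrable_integral_loss {X Y Y' E : Type*} [MeasurableSpace X] [MeasurableSpace Y]
    [MeasurableSpace Y'] [MeasurableSpace E] {ev : E → X → Y'}
    (hev : Measurable fun p : E × X => ev p.1 p.2)
    {ℓ : Y' → Y → ℝ} (hℓmeas : Measurable (Function.uncurry ℓ))
    (hℓ01 : ∀ y' y, ℓ y' y ∈ Set.Icc (0 : ℝ) 1)
    (D : Measure (X × Y)) [IsFiniteMeasure D] (Q : Measure E) [IsFiniteMeasure Q] :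
    Integrable (fun p : X × Y => ∫ h, ℓ (ev h p.1) p.2 ∂Q) D := by
  have hmeas : Measurable fun q : (X × Y) × E => ℓ (ev q.2 q.1.1) q.1.2 :=
    hℓmeas.comp ((hev.comp (measurable_snd.prodMk measurable_fst.fst)).prodMk measurable_fst.snd)
  have hInt : Integrable (fun q : (X × Y) × E => ℓ (ev q.2 q.1.1) q.1.2) (D.prod Q) :=
    .of_bound hmeas.aestronglyMeasurable 1 <| .of_forall fun q => by
      rw [Real.norm_eq_abs, abs_of_nonneg (hℓ01 _ _).1]
      exact (hℓ01 _ _).2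
  exact hInt.integral_prod_left

/-- Under local differential privacy, the gating weights at `x'` bound the gated empirical average
from below, up to a factor `exp ε`. -/
theorem sum_mul_average_le_of_ldp {X Z ι : Type*} [Fintype ι] {m : ℕ} {ε : ℝ} {g : X → ι → ℝ}
    (hLDP : ∀ x x' i, g x i ≤ Real.exp ε * g x' i) (φ : Z → X)
    {L : ι → Z → ℝ} (hL : ∀ i z, 0 ≤ L i z) (S : Fin m → Z) (x' : X) :
    ∑ i, g x' i * ((m : ℝ)⁻¹ * ∑ j, L i (S j)) ≤
      Real.exp ε * ((m : ℝ)⁻¹ * ∑ j, ∑ i, g (φ (S j)) i * L i (S j)) := by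
  have hrw : ∑ i, g x' i * ((m : ℝ)⁻¹ * ∑ j, L i (S j)) =
      (m : ℝ)⁻¹ * ∑ j, ∑ i, g x' i * L i (S j) := by
    rw [Finset.sum_comm, Finset.mul_sum]
    refine Finset.sum_congr rfl fun i _ => ?_
    rw [← Finset.mul_sum]
    ring
  rw [hrw, mul_left_comm]
  refine mul_le_mul_of_nonneg_left ?_ (by positivity)
  simp_rw [Finset.mul_sum, ← mul_assoc]
  exact Finset.sum_le_sum fun j _ => Finset.sum_le_sum fun i _ =>
    mul_le_mul_of_nonneg_right (hLDP _ _ _) (hL _ _)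

/-- Under local differential privacy, the gating weights at `x'` bound the gated expectation
from above, up to a factor `exp (-ε)`. -/
theorem exp_neg_mul_integral_le_of_ldp {X Z ι : Type*} [Fintype ι] [MeasurableSpace Z] {ε : ℝ}
    {g : X → ι → ℝ} (hg0 : ∀ x i, 0 ≤ g x i)
    (hLDP : ∀ x x' i, g x i ≤ Real.exp ε * g x' i) (φ : Z → X) {D : Measure Z}
    {L : ι → Z → ℝ} (hL : ∀ i z, 0 ≤ L i z) (hLint : ∀ i, Integrable (L i) D) (x' : X) :
    Real.exp (-ε) * ∫ z, ∑ i, g (φ z) i * L i z ∂D ≤ ∑ i, g x' i * ∫ z, L i z ∂D := by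
  have hrw : ∑ i, g x' i * ∫ z, L i z ∂D = ∫ z, ∑ i, g x' i * L i z ∂D := by
    rw [integral_finsetSum _ fun i _ => (hLint i).const_mul _]
    simp_rw [integral_const_mul]
  rw [hrw, ← integral_const_mul]
  refine integral_mono_of_nonneg (.of_forall fun z => ?_)
    (integrable_finsetSum _ fun i _ => (hLint i).const_mul _) (.of_forall fun z => ?_)
  · exact mul_nonneg (Real.exp_pos _).le
      (Finset.sum_nonneg fun i _ => mul_nonneg (hg0 _ _) (hL _ _))
  · simp only [Finset.mul_sum, ← mul_assoc]
    refine Finset.sum_le_sum fun i _ => mul_le_mul_of_nonneg_right ?_ (hL _ _)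
    rw [Real.exp_neg, inv_mul_le_iff₀ (Real.exp_pos ε)]
    exact hLDP _ _ _

/-- Lemma 2 of the paper: for any convex `Δ : ℝ² → ℝ` that is
antitone in its first argument and monotone in its second argument, any gating
function satisfying `ε`-LDP, any probability measures `Q i` on the expert spaces,
and any `x' : X`, we have
`Δ(e^ε R_S(g,Q), e^{-ε} R(g,Q)) ≤ ∑ i, g i x' * Δ(R_S(Q i), R(Q i))`. -/
theorem ldp_delta_lemma_gibbs
    {X Y Y' : Type*} [MeasurableSpace X] [MeasurableSpace Y] [MeasurableSpace Y']
    {n : ℕ} (H : Fin n → Type*) [∀ i, MeasurableSpace (H i)]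
    (ev : ∀ i, H i → X → Y')
    (hev : ∀ i, Measurable fun p : H i × X => ev i p.1 p.2)
    (ℓ : Y' → Y → ℝ) (hℓmeas : Measurable (Function.uncurry ℓ))
    (hℓ01 : ∀ y' y, ℓ y' y ∈ Set.Icc (0 : ℝ) 1)
    (D : Measure (X × Y)) [IsProbabilityMeasure D]
    {m : ℕ} (hm : 1 ≤ m) (S : Fin m → X × Y)
    (ε : ℝ) (hε : 0 ≤ ε)
    (Δ : ℝ × ℝ → ℝ) (hConv : ConvexOn ℝ Set.univ Δ)
    (hAnti : ∀ v, Antitone fun u => Δ (u, v))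
    (hMono : ∀ u, Monotone fun v => Δ (u, v))
    (g : X → Fin n → ℝ) (hgmeas : ∀ i, Measurable fun x => g x i)
    (hg0 : ∀ x i, 0 ≤ g x i) (hg1 : ∀ x, ∑ i, g x i = 1)
    (hLDP : ∀ x x' i, g x i ≤ Real.exp ε * g x' i)
    (Q : ∀ i, Measure (H i)) [∀ i, IsProbabilityMeasure (Q i)]
    (x' : X) :
    Δ (Real.exp ε *
         ((m : ℝ)⁻¹ * ∑ j, ∑ i, g (S j).1 i * ∫ h, ℓ (ev i h (S j).1) (S j).2 ∂(Q i)),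
       Real.exp (-ε) * ∫ p, ∑ i, g p.1 i * ∫ h, ℓ (ev i h p.1) p.2 ∂(Q i) ∂D)
      ≤ ∑ i, g x' i *
          Δ ((m : ℝ)⁻¹ * ∑ j, ∫ h, ℓ (ev i h (S j).1) (S j).2 ∂(Q i),
             ∫ p, ∫ h, ℓ (ev i h p.1) p.2 ∂(Q i) ∂D) := by
  have hL : ∀ i (p : X × Y), 0 ≤ ∫ h, ℓ (ev i h p.1) p.2 ∂(Q i) := fun i p =>
    integral_nonneg fun h => (hℓ01 _ _).1
  have hemp := sum_mul_average_le_of_ldp hLDP Prod.fst hL S x'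
  have hrisk := exp_neg_mul_integral_le_of_ldp hg0 hLDP Prod.fst hL
    (fun i => integrable_integral_loss (hev i) hℓmeas hℓ01 D (Q i)) x'
  refine ((hAnti _ hemp).trans (hMono _ hrisk)).trans ?_
  have hjensen := hConv.map_sum_le (t := Finset.univ) (w := g x')
    (p := fun i => ((m : ℝ)⁻¹ * ∑ j, ∫ h, ℓ (ev i h (S j).1) (S j).2 ∂(Q i),
      ∫ p, ∫ h, ℓ (ev i h p.1) p.2 ∂(Q i) ∂D))
    (fun i _ => hg0 x' i) (hg1 x') (fun i _ => Set.mem_univ _)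
  simpa only [Prod.smul_mk, smul_eq_mul, prod_mk_sum] using hjensen
end

section
/- Let ε ≥ 0, let g : X → ℝ^n be a gating function satisfying ε-LDP, let Q_1, …, Q_n be probability measures on the expert spaces H_1, …, H_n, and let x' ∈ X. Then e^ε · R_S(g, Q) ≥ Σ_{i=1}^n g_i(x') · R_S(Q_i). -/
open MeasureTheory Real

/-- under `ε`-LDP of the gating function,
`e^ε R_S(g,Q) ≥ ∑ i, g i x' * R_S(Q i)` for every `x' : X`. -/
theorem ldp_empirical_risk_lower_bound_gibbs
    {X Y Y' : Type*} [MeasurableSpace X] [MeasurableSpace Y] [MeasurableSpace Y']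
    {n : ℕ} (H : Fin n → Type*) [∀ i, MeasurableSpace (H i)]
    (ev : ∀ i, H i → X → Y')
    (hev : ∀ i, Measurable fun p : H i × X => ev i p.1 p.2)
    (ℓ : Y' → Y → ℝ) (hℓmeas : Measurable (Function.uncurry ℓ))
    (hℓ01 : ∀ y' y, ℓ y' y ∈ Set.Icc (0 : ℝ) 1)
    {m : ℕ} (hm : 1 ≤ m) (S : Fin m → X × Y)
    (ε : ℝ) (hε : 0 ≤ ε)
    (g : X → Fin n → ℝ)
    (hg0 : ∀ x i, 0 ≤ g x i) (hg1 : ∀ x, ∑ i, g x i = 1)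
    (hLDP : ∀ x x' i, g x i ≤ Real.exp ε * g x' i)
    (Q : ∀ i, Measure (H i)) [∀ i, IsProbabilityMeasure (Q i)]
    (x' : X) :
    Real.exp ε *
        ((m : ℝ)⁻¹ * ∑ j, ∑ i, g (S j).1 i * ∫ h, ℓ (ev i h (S j).1) (S j).2 ∂(Q i))
      ≥ ∑ i, g x' i * ((m : ℝ)⁻¹ * ∑ j, ∫ h, ℓ (ev i h (S j).1) (S j).2 ∂(Q i)) := by
  have hpos : ∀ i j, 0 ≤ ∫ h, ℓ (ev i h (S j).1) (S j).2 ∂(Q i) := fun i j =>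
    integral_nonneg fun h => (hℓ01 _ _).1
  have hsum : ∑ i, g x' i * ∑ j, ∫ h, ℓ (ev i h (S j).1) (S j).2 ∂(Q i) ≤
      Real.exp ε * ∑ j, ∑ i, g (S j).1 i * ∫ h, ℓ (ev i h (S j).1) (S j).2 ∂(Q i) := by
    simp only [Finset.mul_sum]
    rw [Finset.sum_comm]
    refine Finset.sum_le_sum fun j _ => Finset.sum_le_sum fun i _ => ?_
    rw [← mul_assoc]
    exact mul_le_mul_of_nonneg_right (hLDP x' (S j).1 i) (hpos i j)
  calc ∑ i, g x' i * ((m : ℝ)⁻¹ * ∑ j, ∫ h, ℓ (ev i h (S j).1) (S j).2 ∂(Q i))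
      = (m : ℝ)⁻¹ * ∑ i, g x' i * ∑ j, ∫ h, ℓ (ev i h (S j).1) (S j).2 ∂(Q i) := by
        rw [Finset.mul_sum]
        exact Finset.sum_congr rfl fun i _ => mul_left_comm _ _ _
    _ ≤ (m : ℝ)⁻¹ * (Real.exp ε *
          ∑ j, ∑ i, g (S j).1 i * ∫ h, ℓ (ev i h (S j).1) (S j).2 ∂(Q i)) :=
        mul_le_mul_of_nonneg_left hsum (by positivity)
    _ = _ := mul_left_comm _ _ _
end

section
/- Let ε ≥ 0, let g : X → ℝ^n be a gating function satisfying ε-LDP, let Q_1, …, Q_n be probability measures on the expert spaces H_1, …, H_n, and let x' ∈ X. Then e^{−ε} · R(g, Q) ≤ Σ_{i=1}^n g_i(x') · R(Q_i). -/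
open MeasureTheory Real

/-- The expected loss of an expert drawn from `Q` is an integrable function of the example. -/
theorem integrable_expert_loss
    {X Y Y' H : Type*} [MeasurableSpace X] [MeasurableSpace Y] [MeasurableSpace Y']
    [MeasurableSpace H] {ev : H → X → Y'} (hev : Measurable fun p : H × X => ev p.1 p.2)
    {ℓ : Y' → Y → ℝ} (hℓmeas : Measurable (Function.uncurry ℓ))
    (hℓ01 : ∀ y' y, ℓ y' y ∈ Set.Icc (0 : ℝ) 1)
    (D : Measure (X × Y)) [IsFiniteMeasure D] (Q : Measure H) [IsFiniteMeasure Q] :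
    Integrable (fun p : X × Y => ∫ h, ℓ (ev h p.1) p.2 ∂Q) D := by
  have hmeas : Measurable fun q : (X × Y) × H => ℓ (ev q.2 q.1.1) q.1.2 :=
    hℓmeas.comp <| (hev.comp (measurable_snd.prodMk (measurable_fst.comp measurable_fst))).prodMk
      (measurable_snd.comp measurable_fst)
  have hint : Integrable (fun q : (X × Y) × H => ℓ (ev q.2 q.1.1) q.1.2) (D.prod Q) :=
    Integrable.of_bound hmeas.aestronglyMeasurable 1 <| ae_of_all _ fun q => by
      rw [Real.norm_of_nonneg (hℓ01 _ _).1]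
      exact (hℓ01 _ _).2
  exact hint.integral_prod_left

/-- under `ε`-LDP of the gating function,
`e^{-ε} R(g,Q) ≤ ∑ i, g i x' * R(Q i)` for every `x' : X`. -/
theorem ldp_true_risk_upper_bound_gibbs
    {X Y Y' : Type*} [MeasurableSpace X] [MeasurableSpace Y] [MeasurableSpace Y']
    {n : ℕ} (H : Fin n → Type*) [∀ i, MeasurableSpace (H i)]
    (ev : ∀ i, H i → X → Y')
    (hev : ∀ i, Measurable fun p : H i × X => ev i p.1 p.2)
    (ℓ : Y' → Y → ℝ) (hℓmeas : Measurable (Function.uncurry ℓ))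
    (hℓ01 : ∀ y' y, ℓ y' y ∈ Set.Icc (0 : ℝ) 1)
    (D : Measure (X × Y)) [IsProbabilityMeasure D]
    (ε : ℝ) (hε : 0 ≤ ε)
    (g : X → Fin n → ℝ) (hgmeas : ∀ i, Measurable fun x => g x i)
    (hg0 : ∀ x i, 0 ≤ g x i) (hg1 : ∀ x, ∑ i, g x i = 1)
    (hLDP : ∀ x x' i, g x i ≤ Real.exp ε * g x' i)
    (Q : ∀ i, Measure (H i)) [∀ i, IsProbabilityMeasure (Q i)]
    (x' : X) :
    Real.exp (-ε) * ∫ p, ∑ i, g p.1 i * ∫ h, ℓ (ev i h p.1) p.2 ∂(Q i) ∂D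
      ≤ ∑ i, g x' i * ∫ p, ∫ h, ℓ (ev i h p.1) p.2 ∂(Q i) ∂D := by
  have hint : ∀ i, Integrable (fun p : X × Y => ∫ h, ℓ (ev i h p.1) p.2 ∂(Q i)) D :=
    fun i => integrable_expert_loss (hev i) hℓmeas hℓ01 D (Q i)
  have hnonneg : ∀ i (p : X × Y), 0 ≤ ∫ h, ℓ (ev i h p.1) p.2 ∂(Q i) :=
    fun i p => integral_nonneg fun h => (hℓ01 _ _).1
  have hsum : ∑ i, g x' i * ∫ p, ∫ h, ℓ (ev i h p.1) p.2 ∂(Q i) ∂D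
      = ∫ p, ∑ i, g x' i * ∫ h, ℓ (ev i h p.1) p.2 ∂(Q i) ∂D := by
    rw [integral_finsetSum _ fun i _ => (hint i).const_mul (g x' i)]
    exact Finset.sum_congr rfl fun i _ => (integral_const_mul _ _).symm
  rw [hsum, ← integral_const_mul]
  refine integral_mono_of_nonneg (ae_of_all _ fun p => ?_)
    (integrable_finsetSum _ fun i _ => (hint i).const_mul (g x' i)) (ae_of_all _ fun p => ?_)
  · exact mul_nonneg (Real.exp_pos _).le
      (Finset.sum_nonneg fun i _ => mul_nonneg (hg0 _ i) (hnonneg i p))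
  · simp only [Finset.mul_sum, ← mul_assoc]
    refine Finset.sum_le_sum fun i _ => mul_le_mul_of_nonneg_right ?_ (hnonneg i p)
    rw [Real.exp_neg, inv_mul_le_iff₀ (Real.exp_pos ε)]
    exact hLDP p.1 x' i
end

section
/- Let ε ≥ 0 and let Δ : ℝ² → ℝ be a convex function that is decreasing (antitone) in its first argument and increasing (monotone) in its second argument. Let g : X → ℝ^n be a gating function satisfying ε-LDP, let h_1, …, h_n be experts with h_i : X → Y', and let x' ∈ X. Then Δ(e^ε · R_S(g, h), e^{−ε} · R(g, h)) ≤ Σ_{i=1}^n g_i(x') · Δ(R_S(h_i), R(h_i)). -/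
open MeasureTheory Real

/-- Jensen's inequality followed by monotonicity: `f` is decreasing in the first coordinate and
increasing in the second. -/
lemma ConvexOn.le_sum_of_antitone_of_monotone {ι : Type*} [Fintype ι] {f : ℝ × ℝ → ℝ}
    (hf : ConvexOn ℝ Set.univ f) (hAnti : ∀ v, Antitone fun u => f (u, v))
    (hMono : ∀ u, Monotone fun v => f (u, v)) {w a b : ι → ℝ} (hw0 : ∀ i, 0 ≤ w i)
    (hw1 : ∑ i, w i = 1) {u v : ℝ} (hu : ∑ i, w i * a i ≤ u) (hv : v ≤ ∑ i, w i * b i) :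
    f (u, v) ≤ ∑ i, w i * f (a i, b i) := by
  have hJensen := hf.map_sum_le (t := Finset.univ) (w := w) (p := fun i => (a i, b i))
    (fun i _ => hw0 i) hw1 (fun _ _ => Set.mem_univ _)
  have hsum : ∑ i, w i • (a i, b i) = (∑ i, w i * a i, ∑ i, w i * b i) := by
    ext <;> simp [Prod.fst_sum, Prod.snd_sum]
  rw [hsum] at hJensen
  exact ((hAnti v hu).trans (hMono _ hv)).trans hJensen

/-- Lemma 6 of the paper: for any convex `Δ : ℝ² → ℝ` that is
antitone in its first argument and monotone in its second argument, any gating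
function satisfying `ε`-LDP, any experts `h i : X → Y'`, and any `x' : X`,
`Δ(e^ε R_S(g,h), e^{-ε} R(g,h)) ≤ ∑ i, g i x' * Δ(R_S(h i), R(h i))`. -/
theorem ldp_delta_lemma_deterministic
    {X Y Y' : Type*} [MeasurableSpace X] [MeasurableSpace Y] [MeasurableSpace Y']
    {n : ℕ}
    (ℓ : Y' → Y → ℝ) (hℓmeas : Measurable (Function.uncurry ℓ))
    (hℓ01 : ∀ y' y, ℓ y' y ∈ Set.Icc (0 : ℝ) 1)
    (D : Measure (X × Y)) [IsProbabilityMeasure D]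
    {m : ℕ} (hm : 1 ≤ m) (S : Fin m → X × Y)
    (ε : ℝ) (hε : 0 ≤ ε)
    (Δ : ℝ × ℝ → ℝ) (hConv : ConvexOn ℝ Set.univ Δ)
    (hAnti : ∀ v, Antitone fun u => Δ (u, v))
    (hMono : ∀ u, Monotone fun v => Δ (u, v))
    (g : X → Fin n → ℝ) (hgmeas : ∀ i, Measurable fun x => g x i)
    (hg0 : ∀ x i, 0 ≤ g x i) (hg1 : ∀ x, ∑ i, g x i = 1)
    (hLDP : ∀ x x' i, g x i ≤ Real.exp ε * g x' i)
    (h : Fin n → X → Y') (hh : ∀ i, Measurable (h i))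
    (x' : X) :
    Δ (Real.exp ε * ((m : ℝ)⁻¹ * ∑ j, ∑ i, g (S j).1 i * ℓ (h i (S j).1) (S j).2),
       Real.exp (-ε) * ∫ p, ∑ i, g p.1 i * ℓ (h i p.1) p.2 ∂D)
      ≤ ∑ i, g x' i *
          Δ ((m : ℝ)⁻¹ * ∑ j, ℓ (h i (S j).1) (S j).2,
             ∫ p, ℓ (h i p.1) p.2 ∂D) := by
  have hloss (i : Fin n) : Measurable fun p : X × Y => ℓ (h i p.1) p.2 :=
    hℓmeas.comp (((hh i).comp measurable_fst).prodMk measurable_snd)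
  have hint (i : Fin n) : Integrable (fun p : X × Y => ℓ (h i p.1) p.2) D :=
    .of_mem_Icc 0 1 (hloss i).aemeasurable (.of_forall fun _ => hℓ01 _ _)
  have hg_le_one (x : X) (i : Fin n) : g x i ≤ 1 :=
    hg1 x ▸ Finset.single_le_sum (fun k _ => hg0 x k) (Finset.mem_univ i)
  have hgint (i : Fin n) : Integrable (fun p : X × Y => g p.1 i * ℓ (h i p.1) p.2) D :=
    .of_mem_Icc 0 1 (((hgmeas i).comp measurable_fst).mul (hloss i)).aemeasurable
      (.of_forall fun _ => ⟨mul_nonneg (hg0 _ _) (hℓ01 _ _).1,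
        mul_le_one₀ (hg_le_one _ _) (hℓ01 _ _).1 (hℓ01 _ _).2⟩)
  refine hConv.le_sum_of_antitone_of_monotone hAnti hMono (hg0 x') (hg1 x') ?_ ?_
  · calc ∑ i, g x' i * ((m : ℝ)⁻¹ * ∑ j, ℓ (h i (S j).1) (S j).2)
        = (m : ℝ)⁻¹ * ∑ j, ∑ i, g x' i * ℓ (h i (S j).1) (S j).2 := by
          rw [Finset.sum_comm, Finset.mul_sum]
          refine Finset.sum_congr rfl fun i _ => ?_
          rw [mul_left_comm, ← Finset.mul_sum]
      _ ≤ (m : ℝ)⁻¹ * ∑ j, ∑ i, Real.exp ε * g (S j).1 i * ℓ (h i (S j).1) (S j).2 := by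
          gcongr with j _ i _
          · exact (hℓ01 _ _).1
          · exact hLDP _ _ _
      _ = Real.exp ε * ((m : ℝ)⁻¹ * ∑ j, ∑ i, g (S j).1 i * ℓ (h i (S j).1) (S j).2) := by
          simp_rw [mul_assoc, ← Finset.mul_sum]
          ring
  · rw [integral_finsetSum _ fun i _ => hgint i, Finset.mul_sum]
    refine Finset.sum_le_sum fun i _ => ?_
    rw [← integral_const_mul, ← integral_const_mul]
    refine integral_mono ((hgint i).const_mul _) ((hint i).const_mul _) fun p => ?_
    have hg_le : Real.exp (-ε) * g p.1 i ≤ g x' i := by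
      rw [Real.exp_neg, inv_mul_le_iff₀ (Real.exp_pos ε)]
      exact hLDP _ _ _
    simpa only [mul_assoc] using mul_le_mul_of_nonneg_right hg_le (hℓ01 (h i p.1) p.2).1
end

section
/- Let ε ≥ 0, let g : X → ℝ^n be a gating function satisfying ε-LDP, let h_1, …, h_n be experts with h_i : X → Y', and let x' ∈ X. Then e^ε · R_S(g, h) ≥ Σ_{i=1}^n g_i(x') · R_S(h_i) and e^{−ε} · R(g, h) ≤ Σ_{i=1}^n g_i(x') · R(h_i). -/
open MeasureTheory Real


/-- under `ε`-LDP of the gating function, for deterministic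
experts `h i : X → Y'` and any `x' : X`,
`e^ε R_S(g,h) ≥ ∑ i, g i x' * R_S(h i)` and `e^{-ε} R(g,h) ≤ ∑ i, g i x' * R(h i)`. -/
theorem ldp_risk_bounds_deterministic
    {X Y Y' : Type*} [MeasurableSpace X] [MeasurableSpace Y] [MeasurableSpace Y']
    {n : ℕ}
    (ℓ : Y' → Y → ℝ) (hℓmeas : Measurable (Function.uncurry ℓ))
    (hℓ01 : ∀ y' y, ℓ y' y ∈ Set.Icc (0 : ℝ) 1)
    (D : Measure (X × Y)) [IsProbabilityMeasure D]
    {m : ℕ} (hm : 1 ≤ m) (S : Fin m → X × Y)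
    (ε : ℝ) (hε : 0 ≤ ε)
    (g : X → Fin n → ℝ) (hgmeas : ∀ i, Measurable fun x => g x i)
    (hg0 : ∀ x i, 0 ≤ g x i) (hg1 : ∀ x, ∑ i, g x i = 1)
    (hLDP : ∀ x x' i, g x i ≤ Real.exp ε * g x' i)
    (h : Fin n → X → Y') (hh : ∀ i, Measurable (h i))
    (x' : X) :
    Real.exp ε * ((m : ℝ)⁻¹ * ∑ j, ∑ i, g (S j).1 i * ℓ (h i (S j).1) (S j).2)
        ≥ ∑ i, g x' i * ((m : ℝ)⁻¹ * ∑ j, ℓ (h i (S j).1) (S j).2)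
      ∧
    Real.exp (-ε) * ∫ p, ∑ i, g p.1 i * ℓ (h i p.1) p.2 ∂D
        ≤ ∑ i, g x' i * ∫ p, ℓ (h i p.1) p.2 ∂D := by
  have hloss (i : Fin n) : Measurable fun p : X × Y => ℓ (h i p.1) p.2 :=
    hℓmeas.comp (((hh i).comp measurable_fst).prodMk measurable_snd)
  have hint (i : Fin n) : Integrable (fun p : X × Y => ℓ (h i p.1) p.2) D :=
    Integrable.of_mem_Icc 0 1 (hloss i).aemeasurable (ae_of_all _ fun p => hℓ01 _ _)
  have hg_le (x : X) (i : Fin n) : g x i ≤ 1 :=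
    hg1 x ▸ Finset.single_le_sum (fun k _ => hg0 x k) (Finset.mem_univ i)
  have hgint (i : Fin n) : Integrable (fun p : X × Y => g p.1 i * ℓ (h i p.1) p.2) D :=
    Integrable.of_mem_Icc 0 1
      (((hgmeas i).comp measurable_fst).mul (hloss i)).aemeasurable
      (ae_of_all _ fun p => ⟨mul_nonneg (hg0 _ _) (hℓ01 _ _).1,
        mul_le_one₀ (hg_le _ _) (hℓ01 _ _).1 (hℓ01 _ _).2⟩)
  constructor
  · calc ∑ i, g x' i * ((m : ℝ)⁻¹ * ∑ j, ℓ (h i (S j).1) (S j).2)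
        = (m : ℝ)⁻¹ * ∑ j, ∑ i, g x' i * ℓ (h i (S j).1) (S j).2 := by
          rw [Finset.sum_comm, Finset.mul_sum]
          refine Finset.sum_congr rfl fun i _ => ?_
          rw [← Finset.mul_sum, mul_left_comm]
      _ ≤ (m : ℝ)⁻¹ * ∑ j, ∑ i, exp ε * g (S j).1 i * ℓ (h i (S j).1) (S j).2 := by
          gcongr with j _ i _
          · exact (hℓ01 _ _).1
          · exact hLDP _ _ _
      _ = exp ε * ((m : ℝ)⁻¹ * ∑ j, ∑ i, g (S j).1 i * ℓ (h i (S j).1) (S j).2) := by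
          simp only [mul_assoc, ← Finset.mul_sum]
          ring
  · rw [integral_finsetSum _ fun i _ => hgint i, Finset.mul_sum]
    refine Finset.sum_le_sum fun i _ => ?_
    rw [← integral_const_mul, ← integral_const_mul]
    refine integral_mono ((hgint i).const_mul _) ((hint i).const_mul _) fun p => ?_
    have hg : exp (-ε) * g p.1 i ≤ g x' i := by
      rw [exp_neg, inv_mul_le_iff₀ (exp_pos ε)]
      exact hLDP _ _ _
    simpa only [mul_assoc] using mul_le_mul_of_nonneg_right hg (hℓ01 (h i p.1) p.2).1
end
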